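/- Let Q be a finite connected (undirected) graph with vertex set Q₀. For J ⊆ Q₀, let e_J := Σ_{j∈J} e_j ∈ ℤ^{Q₀}, where (e_j) is the standard basis. Then the set S_Q := { e_J : J ⊆ Q₀ such that the induced subgraphs on both J and Q₀ \ J are connected } spans ℤ^{Q₀} as a ℤ-module. -/

import Mathlib

/-- The set of vertices lying in a given component of the graph with `v` removed. -/
def compSet {V : Type*} (Q : SimpleGraph V) (v : V)
    (c : (Q.induce {v}ᶜ).ConnectedComponent) : Set V :=
  {x | ∃ h : x ∈ ({v}ᶜ : Set V), (Q.induce {v}ᶜ).connectedComponentMk ⟨x, h⟩ = c}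

theorem compSet_preconnected {V : Type*} (Q : SimpleGraph V) (v : V)
    (c : (Q.induce {v}ᶜ).ConnectedComponent) : (Q.induce (compSet Q v c)).Preconnected := by
  have key : ∀ (a b : ({v}ᶜ : Set V)) (_ : (Q.induce {v}ᶜ).Walk a b)
      (ha : a.1 ∈ compSet Q v c) (hb : b.1 ∈ compSet Q v c),
      (Q.induce (compSet Q v c)).Reachable ⟨a.1, ha⟩ ⟨b.1, hb⟩ := by
    intro a b p
    induction p with
    | nil => intro ha hb; exact SimpleGraph.Reachable.refl _
    | @cons a u b hadj p ih =>
      intro ha hb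
      have hu : u.1 ∈ compSet Q v c := by
        obtain ⟨h, hc⟩ := ha
        refine ⟨u.2, ?_⟩
        rw [← hc]
        exact SimpleGraph.ConnectedComponent.sound hadj.symm.reachable
      refine SimpleGraph.Reachable.trans (SimpleGraph.Adj.reachable ?_) (ih hu hb)
      exact hadj
  rintro ⟨a, ha⟩ ⟨b, hb⟩
  have ha' := ha
  have hb' := hb
  obtain ⟨h1, h2⟩ := ha'
  obtain ⟨h3, h4⟩ := hb'
  obtain ⟨p⟩ := SimpleGraph.ConnectedComponent.exact (h2.trans h4.symm)
  exact key _ _ p ha hb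

theorem compSet_compl_preconnected {V : Type*} (Q : SimpleGraph V) (hQ : Q.Connected) (v : V)
    (c : (Q.induce {v}ᶜ).ConnectedComponent) : (Q.induce (compSet Q v c)ᶜ).Preconnected := by
  have hv : v ∈ (compSet Q v c)ᶜ := by
    rintro ⟨h, -⟩
    exact h rfl
  have key : ∀ (a b : V) (_ : Q.Walk a b) (_ : b = v) (ha : a ∈ (compSet Q v c)ᶜ),
      (Q.induce (compSet Q v c)ᶜ).Reachable ⟨a, ha⟩ ⟨v, hv⟩ := by
    intro a b p
    induction p with
    | nil => intro hb ha; subst hb; exact SimpleGraph.Reachable.refl _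
    | @cons a u b hadj p ih =>
      intro hb ha
      by_cases hav : a = v
      · subst hav; exact SimpleGraph.Reachable.refl _
      have hu : u ∈ (compSet Q v c)ᶜ := by
        rintro ⟨h, hc⟩
        refine ha ⟨hav, ?_⟩
        rw [← hc]
        apply SimpleGraph.ConnectedComponent.sound
        apply SimpleGraph.Adj.reachable
        exact hadj
      refine SimpleGraph.Reachable.trans (SimpleGraph.Adj.reachable ?_) (ih hb hu)
      exact hadj
  rintro ⟨a, ha⟩ ⟨b, hb⟩
  obtain ⟨p⟩ := hQ.preconnected a v
  obtain ⟨q⟩ := hQ.preconnected b v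
  exact (key a v p rfl ha).trans (key b v q rfl hb).symm

theorem stmt3 {V : Type*} [Fintype V] (Q : SimpleGraph V) (hQ : Q.Connected) :
    Submodule.span ℤ
      { x : V → ℤ | ∃ J : Set V,
          (Q.induce J).Preconnected ∧ (Q.induce (Jᶜ)).Preconnected ∧
          x = J.indicator (fun _ => (1 : ℤ)) } = ⊤ := by
  classical
  rw [eq_top_iff, ← (Pi.basisFun ℤ V).span_eq, Submodule.span_le]
  rintro _ ⟨v, rfl⟩
  have : Fintype (Q.induce {v}ᶜ).ConnectedComponent := Fintype.ofFinite _
  have e : Pi.basisFun ℤ V v = (Set.univ : Set V).indicator (fun _ => (1 : ℤ)) -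
      ∑ c, (compSet Q v c).indicator (fun _ => (1 : ℤ)) := by
    funext x
    simp only [Pi.basisFun_apply, Pi.sub_apply, Finset.sum_apply, Set.indicator_univ]
    by_cases hx : x = v
    · subst hx
      simp [compSet, Set.indicator_apply]
    · have hx' : x ∈ ({v}ᶜ : Set V) := hx
      have : ∀ c, (compSet Q v c).indicator (fun _ => (1 : ℤ)) x =
          if (Q.induce {v}ᶜ).connectedComponentMk ⟨x, hx'⟩ = c then 1 else 0 := by
        intro c
        rw [Set.indicator_apply]
        congr 1
        exact propext ⟨fun h => h.2, fun h => ⟨hx', h⟩⟩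
      simp [this, hx]
  rw [e]
  refine Submodule.sub_mem _ (Submodule.subset_span ⟨Set.univ, ?_, ?_, rfl⟩)
    (Submodule.sum_mem _ fun c _ => Submodule.subset_span
      ⟨_, compSet_preconnected Q v c, compSet_compl_preconnected Q hQ v c, rfl⟩)
  · rintro ⟨a, ha⟩ ⟨b, hb⟩
    obtain ⟨p⟩ := hQ.preconnected a b
    exact ⟨p.induce Set.univ (fun _ _ => trivial)⟩
  · rintro ⟨a, ha⟩
    exact absurd trivial ha
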